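/- arXiv:2307.02944 — 4 statements merged into one kernel-verified Lean document; each statement's English description precedes it below -/
import Mathlib

section
/- Let A be a bounded residuated lattice and F a proper implicative filter of A. Then F is maximal if and only if for every a ∈ A: a ∉ F if and only if there exists n > 0 such that ¬(aⁿ) ∈ F. -/
universe u

/-- A bounded (integral, commutative) residuated lattice: a bounded lattice
with a commutative monoid operation `mul` (with unit `⊤`) and a residuum
`himp` satisfying the residuation condition. -/
class BRL (α : Type u) extends Lattice α, BoundedOrder α where
  mul : α → α → α
  himp : α → α → α
  mul_comm : ∀ a b : α, mul a b = mul b a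
  mul_assoc : ∀ a b c : α, mul (mul a b) c = mul a (mul b c)
  mul_top : ∀ a : α, mul a ⊤ = a
  residuation : ∀ a b c : α, mul a b ≤ c ↔ a ≤ himp b c

namespace BRL

variable {α : Type u} [BRL α]

/-- `¬a := a → ⊥`. -/
def neg (a : α) : α := himp a ⊥

/-- `a + b := ¬(¬a · ¬b)`. -/
def add (a b : α) : α := neg (mul (neg a) (neg b))

/-- Powers: `a⁰ = ⊤`, `aⁿ⁺¹ = a · aⁿ`. -/
def pow (a : α) : ℕ → α
  | 0 => ⊤
  | n + 1 => mul a (pow a n)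

/-- Multiples: `0.a = ⊥`, `(n+1).a = a + n.a`. -/
def nmul : ℕ → α → α
  | 0, _ => ⊥
  | n + 1, a => add a (nmul n a)

/-- Implicative filter. -/
def IsFilter (F : Set α) : Prop :=
  ⊤ ∈ F ∧ (∀ a b : α, a ∈ F → a ≤ b → b ∈ F) ∧
    (∀ a b : α, a ∈ F → b ∈ F → mul a b ∈ F)

/-- The smallest implicative filter containing `S`. -/
def genFilter (S : Set α) : Set α := ⋂₀ {F : Set α | IsFilter F ∧ S ⊆ F}

/-- Maximal (proper) implicative filter. -/
def IsMaximal (M : Set α) : Prop :=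
  IsFilter M ∧ M ≠ Set.univ ∧ ∀ G : Set α, IsFilter G → M ⊂ G → G = Set.univ

/-- Prime (proper) implicative filter. -/
def IsPrime (P : Set α) : Prop :=
  IsFilter P ∧ P ≠ Set.univ ∧ ∀ a b : α, a ⊔ b ∈ P → a ∈ P ∨ b ∈ P

/-- Minimal prime implicative filter (minimal among prime implicative filters). -/
def IsMinimalPrime (P : Set α) : Prop :=
  IsPrime P ∧ ∀ Q : Set α, IsPrime Q → Q ⊆ P → Q = P

/-- The radical: intersection of all maximal implicative filters. -/
def Rad : Set α := {a : α | ∀ M : Set α, IsMaximal M → a ∈ M}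

/-- Boolean (complemented) element. -/
def Boolean (b : α) : Prop := b ⊔ neg b = ⊤

/-- Stone ultrafilter: an implicative filter generated by an ultrafilter of
the Boolean algebra of Boolean elements. -/
def IsStoneUltra (F : Set α) : Prop :=
  IsFilter F ∧ F = genFilter (F ∩ {b : α | Boolean b}) ∧ (⊥ : α) ∉ F ∧
    ∀ b : α, Boolean b → b ∈ F ∨ neg b ∈ F

theorem mul_le_mul_of_le {a b : α} (h : a ≤ b) (c : α) : mul a c ≤ mul b c :=
  (residuation _ _ _).2 (h.trans ((residuation _ _ _).1 le_rfl))

theorem mul_le_mul_both {a b c d : α} (h : a ≤ b) (h' : c ≤ d) : mul a c ≤ mul b d := by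
  refine (mul_le_mul_of_le h c).trans ?_
  rw [mul_comm b c, mul_comm b d]
  exact mul_le_mul_of_le h' b

theorem mul_le_left (a b : α) : mul a b ≤ a := by
  simpa only [mul_top] using mul_le_mul_both (le_refl a) (le_top : b ≤ ⊤)

theorem mul_le_right (a b : α) : mul a b ≤ b := by
  rw [mul_comm]
  exact mul_le_left b a

theorem mul_mul_mul_comm (a b c d : α) :
    mul (mul a b) (mul c d) = mul (mul a c) (mul b d) := by
  rw [mul_assoc, mul_assoc, ← mul_assoc b c d, mul_comm b c, mul_assoc c b d]

theorem pow_add (a : α) (m n : ℕ) : pow a (m + n) = mul (pow a m) (pow a n) := by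
  induction m with
  | zero => rw [Nat.zero_add, pow, mul_comm, mul_top]
  | succ m ih => rw [Nat.succ_add, pow, pow, ih, mul_assoc]

theorem IsFilter.pow_mem {F : Set α} (hF : IsFilter F) {a : α} (ha : a ∈ F) (n : ℕ) :
    pow a n ∈ F := by
  induction n with
  | zero => exact hF.1
  | succ n ih => exact hF.2.2 _ _ ha ih

theorem IsFilter.eq_univ_of_bot_mem {F : Set α} (hF : IsFilter F) (h : ⊥ ∈ F) :
    F = Set.univ :=
  Set.eq_univ_of_forall fun x => hF.2.1 _ x h bot_le

theorem IsFilter.eq_univ_of_neg_pow_mem {F : Set α} (hF : IsFilter F) {a : α} {n : ℕ}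
    (ha : a ∈ F) (hn : neg (pow a n) ∈ F) : F = Set.univ :=
  hF.eq_univ_of_bot_mem <|
    hF.2.1 _ _ (hF.2.2 _ _ hn (hF.pow_mem ha n)) ((residuation _ _ _).2 le_rfl)

/-- The filter generated by a filter `F` together with an element `a`. -/
def adjoin (F : Set α) (a : α) : Set α := {x | ∃ f ∈ F, ∃ n : ℕ, mul f (pow a n) ≤ x}

theorem IsFilter.adjoin {F : Set α} (hF : IsFilter F) (a : α) : IsFilter (adjoin F a) := by
  refine ⟨⟨⊤, hF.1, 0, le_top⟩, ?_, ?_⟩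
  · rintro x y ⟨f, hf, n, h⟩ hxy
    exact ⟨f, hf, n, h.trans hxy⟩
  · rintro x y ⟨f, hf, n, h⟩ ⟨g, hg, m, h'⟩
    refine ⟨mul f g, hF.2.2 _ _ hf hg, n + m, ?_⟩
    rw [pow_add, mul_mul_mul_comm]
    exact mul_le_mul_both h h'

theorem subset_adjoin (F : Set α) (a : α) : F ⊆ adjoin F a :=
  fun x hx => ⟨x, hx, 0, mul_le_left _ _⟩

theorem IsFilter.mem_adjoin {F : Set α} (hF : IsFilter F) (a : α) : a ∈ BRL.adjoin F a :=
  ⟨⊤, hF.1, 1, (mul_le_right _ _).trans (mul_le_left _ _)⟩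

theorem maximal_iff (F : Set α) (hF : IsFilter F) (hproper : F ≠ Set.univ) :
    IsMaximal F ↔ ∀ a : α, a ∉ F ↔ ∃ n : ℕ, 0 < n ∧ neg (pow a n) ∈ F := by
  constructor
  · rintro ⟨-, -, hmax⟩ a
    constructor
    · intro ha
      have huniv : adjoin F a = Set.univ := hmax _ (hF.adjoin a)
        ⟨subset_adjoin F a, fun h => ha (h (hF.mem_adjoin a))⟩
      obtain ⟨f, hf, n, h⟩ : ⊥ ∈ adjoin F a := huniv ▸ Set.mem_univ _
      exact ⟨n + 1, n.succ_pos, hF.2.1 _ _ hf <| (residuation _ _ _).1 <|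
        (mul_le_mul_both le_rfl (mul_le_right _ _)).trans h⟩
    · rintro ⟨n, -, hn⟩ ha
      exact hproper (hF.eq_univ_of_neg_pow_mem ha hn)
  · intro h
    refine ⟨hF, hproper, fun G hG hFG => ?_⟩
    obtain ⟨a, haG, haF⟩ := Set.exists_of_ssubset hFG
    obtain ⟨n, -, hn⟩ := (h a).1 haF
    exact hG.eq_univ_of_neg_pow_mem haG (hFG.1 hn)

end BRL
end

section
/- Let A be a bounded residuated lattice. The set B(A) of Boolean elements of A contains ⊥ and ⊤, is closed under ·, →, ∧, ∨ and ¬, and ⟨B(A); ∧, ∨, ¬, ⊥, ⊤⟩ is a Boolean algebra in which b ∧ c = b·c and b ∨ c = b + c for all b, c ∈ B(A). -/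
universe u

namespace BRL

variable {α : Type u} [BRL α]

theorem mul_le_mul {a b c d : α} (hab : a ≤ b) (hcd : c ≤ d) : mul a c ≤ mul b d := by
  have mono_left {x y : α} (z : α) (h : x ≤ y) : mul x z ≤ mul y z :=
    (residuation _ _ _).2 (h.trans ((residuation _ _ _).1 le_rfl))
  calc mul a c ≤ mul b c := mono_left c hab
    _ = mul c b := mul_comm _ _
    _ ≤ mul d b := mono_left b hcd
    _ = mul b d := mul_comm _ _

theorem sup_mul (a b c : α) : mul (a ⊔ b) c = mul a c ⊔ mul b c := by
  apply le_antisymm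
  · rw [residuation]
    exact sup_le ((residuation _ _ _).1 le_sup_left) ((residuation _ _ _).1 le_sup_right)
  · exact sup_le (mul_le_mul le_sup_left le_rfl) (mul_le_mul le_sup_right le_rfl)

theorem mul_sup (a b c : α) : mul a (b ⊔ c) = mul a b ⊔ mul a c := by
  rw [mul_comm, sup_mul, mul_comm b, mul_comm c]

theorem le_neg_iff (a b : α) : a ≤ neg b ↔ mul a b = ⊥ := by
  rw [neg, ← residuation, le_bot_iff]

theorem neg_mul_self (a : α) : mul (neg a) a = ⊥ := (le_neg_iff _ _).1 le_rfl

theorem mul_neg_self (a : α) : mul a (neg a) = ⊥ := by rw [mul_comm, neg_mul_self]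

theorem sup_mul_eq_top {a b c : α} (hb : a ⊔ b = ⊤) (hc : a ⊔ c = ⊤) : a ⊔ mul b c = ⊤ := by
  rw [eq_top_iff]
  calc ⊤ = mul (a ⊔ b) (a ⊔ c) := by rw [hb, hc, mul_top]
    _ = mul a (a ⊔ c) ⊔ (mul b a ⊔ mul b c) := by rw [sup_mul, mul_sup b]
    _ ≤ a ⊔ mul b c :=
      sup_le ((mul_le_left _ _).trans le_sup_left)
        (sup_le ((mul_le_right _ _).trans le_sup_left) le_sup_right)

/-- If `x ⊔ y = ⊤` and `x · y = ⊥`, then `x` is the negation of `y`. -/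
theorem neg_eq_of_sup_eq_top_of_mul_eq_bot {x y : α} (hs : x ⊔ y = ⊤) (hm : mul x y = ⊥) :
    neg y = x := by
  apply le_antisymm _ ((le_neg_iff _ _).2 hm)
  calc neg y = mul (neg y) (x ⊔ y) := by rw [hs, mul_top]
    _ = mul (neg y) x := by rw [mul_sup, neg_mul_self, sup_bot_eq]
    _ ≤ x := mul_le_right _ _

theorem Boolean.of_sup_eq_top_of_mul_eq_bot {x y : α} (hs : x ⊔ y = ⊤) (hm : mul x y = ⊥) :
    Boolean x := by
  rw [sup_comm] at hs
  rw [mul_comm] at hm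
  rw [Boolean, neg_eq_of_sup_eq_top_of_mul_eq_bot hs hm, sup_comm, hs]

theorem Boolean.neg {b : α} (hb : Boolean b) : Boolean (neg b) :=
  .of_sup_eq_top_of_mul_eq_bot ((sup_comm _ _).trans hb) (neg_mul_self b)

theorem Boolean.inf_eq_mul {b : α} (hb : Boolean b) (x : α) : b ⊓ x = mul b x := by
  apply le_antisymm _ (le_inf (mul_le_left _ _) (mul_le_right _ _))
  calc b ⊓ x = mul (b ⊔ BRL.neg b) (b ⊓ x) := by rw [hb, mul_comm, mul_top]
    _ = mul b (b ⊓ x) ⊔ mul (BRL.neg b) (b ⊓ x) := sup_mul _ _ _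
    _ ≤ mul b x ⊔ mul (BRL.neg b) b :=
      sup_le_sup (mul_le_mul le_rfl inf_le_right) (mul_le_mul le_rfl inf_le_left)
    _ = mul b x := by rw [neg_mul_self, sup_bot_eq]

theorem Boolean.himp_eq {b : α} (hb : Boolean b) (c : α) : himp b c = BRL.neg b ⊔ c := by
  apply le_antisymm
  · calc himp b c = mul (himp b c) (b ⊔ BRL.neg b) := by rw [hb, mul_top]
      _ = mul (himp b c) b ⊔ mul (himp b c) (BRL.neg b) := mul_sup _ _ _
      _ ≤ c ⊔ BRL.neg b := sup_le_sup ((residuation _ _ _).2 le_rfl) (mul_le_right _ _)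
      _ = BRL.neg b ⊔ c := sup_comm _ _
  · rw [← residuation, sup_mul, neg_mul_self, bot_sup_eq]
    exact mul_le_left _ _

theorem Boolean.sup_sup_mul_neg {b c : α} (hb : Boolean b) (hc : Boolean c) :
    (b ⊔ c) ⊔ mul (BRL.neg b) (BRL.neg c) = ⊤ := by
  apply sup_mul_eq_top
  · rw [sup_right_comm, hb, top_sup_eq]
  · rw [sup_assoc, hc, sup_top_eq]

theorem sup_mul_mul_neg (b c : α) : mul (b ⊔ c) (mul (neg b) (neg c)) = ⊥ := by
  rw [sup_mul, sup_eq_bot_iff]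
  constructor <;> rw [← le_bot_iff]
  · exact (mul_le_mul le_rfl (mul_le_left _ _)).trans (mul_neg_self b).le
  · exact (mul_le_mul le_rfl (mul_le_right _ _)).trans (mul_neg_self c).le

theorem Boolean.sup {b c : α} (hb : Boolean b) (hc : Boolean c) : Boolean (b ⊔ c) :=
  .of_sup_eq_top_of_mul_eq_bot (hb.sup_sup_mul_neg hc) (sup_mul_mul_neg b c)

theorem Boolean.sup_eq_add {b c : α} (hb : Boolean b) (hc : Boolean c) : b ⊔ c = add b c :=
  (neg_eq_of_sup_eq_top_of_mul_eq_bot (hb.sup_sup_mul_neg hc) (sup_mul_mul_neg b c)).symm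

theorem Boolean.mul {b c : α} (hb : Boolean b) (hc : Boolean c) : Boolean (mul b c) := by
  apply Boolean.of_sup_eq_top_of_mul_eq_bot (y := BRL.neg b ⊔ BRL.neg c)
  · rw [sup_comm]
    apply sup_mul_eq_top
    · rw [sup_right_comm, sup_comm (BRL.neg b), hb, top_sup_eq]
    · rw [sup_assoc, sup_comm (BRL.neg c), hc, sup_top_eq]
  · rw [mul_sup, sup_eq_bot_iff]
    constructor <;> rw [← le_bot_iff]
    · exact (mul_le_mul (mul_le_left _ _) le_rfl).trans (mul_neg_self b).le
    · exact (mul_le_mul (mul_le_right _ _) le_rfl).trans (mul_neg_self c).le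

theorem boolean_elements_boolean_algebra :
    Boolean (⊥ : α) ∧ Boolean (⊤ : α) ∧
    (∀ b c : α, Boolean b → Boolean c →
      Boolean (mul b c) ∧ Boolean (himp b c) ∧ Boolean (b ⊓ c) ∧ Boolean (b ⊔ c)) ∧
    (∀ b : α, Boolean b → Boolean (neg b)) ∧
    (∀ b : α, Boolean b → b ⊓ neg b = ⊥ ∧ b ⊔ neg b = ⊤) ∧
    (∀ b c d : α, Boolean b → Boolean c → Boolean d →
      b ⊓ (c ⊔ d) = (b ⊓ c) ⊔ (b ⊓ d)) ∧
    (∀ b c : α, Boolean b → Boolean c → b ⊓ c = mul b c ∧ b ⊔ c = add b c) := by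
  refine ⟨?_, ?_, fun b c hb hc => ⟨hb.mul hc, ?_, ?_, hb.sup hc⟩, fun b hb => hb.neg,
    fun b hb => ⟨?_, hb⟩, fun b c d hb _ _ => ?_,
    fun b c hb hc => ⟨hb.inf_eq_mul c, hb.sup_eq_add hc⟩⟩
  · exact .of_sup_eq_top_of_mul_eq_bot (bot_sup_eq _) (mul_top _)
  · exact top_sup_eq _
  · rw [hb.himp_eq]
    exact hb.neg.sup hc
  · rw [hb.inf_eq_mul]
    exact hb.mul hc
  · rw [hb.inf_eq_mul, mul_neg_self]
  · simp only [hb.inf_eq_mul, mul_sup]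

end BRL
end

section
/- Let A be a bounded residuated lattice and F a proper implicative filter of A satisfying: for every a ∈ A, a ∨ ¬a ∈ F implies a ∈ F or ¬a ∈ F. Then for every Boolean b ∈ A, b ∈ F or ¬b ∈ F; consequently ⟨F ∩ B(A)⟩ is a Stone ultrafilter of A contained in F. -/
universe u

namespace BRL

variable {α : Type u} [BRL α]

theorem le_neg_neg (b : α) : b ≤ neg (neg b) := by
  unfold neg
  rw [← residuation, mul_comm, residuation]

theorem subset_genFilter (S : Set α) : S ⊆ genFilter S :=
  Set.subset_sInter fun _ hG => hG.2

theorem genFilter_subset {S F : Set α} (hF : IsFilter F) (hS : S ⊆ F) : genFilter S ⊆ F :=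
  Set.sInter_subset_of_mem ⟨hF, hS⟩

theorem isFilter_genFilter (S : Set α) : IsFilter (genFilter S) :=
  ⟨fun _ hG => hG.1.1,
    fun a b ha hab G hG => hG.1.2.1 a b (ha G hG) hab,
    fun a b ha hb G hG => hG.1.2.2 a b (ha G hG) (hb G hG)⟩

theorem IsFilter.bot_notMem {F : Set α} (hF : IsFilter F) (hproper : F ≠ Set.univ) :
    (⊥ : α) ∉ F :=
  fun h => hproper (Set.eq_univ_of_forall fun a => hF.2.1 ⊥ a h bot_le)

theorem di_filter_stone_ultra (F : Set α) (hF : IsFilter F) (hproper : F ≠ Set.univ)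
    (hdi : ∀ a : α, a ⊔ neg a ∈ F → a ∈ F ∨ neg a ∈ F) :
    (∀ b : α, Boolean b → b ∈ F ∨ neg b ∈ F) ∧
    IsStoneUltra (genFilter (F ∩ {b : α | Boolean b})) ∧
    genFilter (F ∩ {b : α | Boolean b}) ⊆ F := by
  have hbool : ∀ b : α, Boolean b → b ∈ F ∨ neg b ∈ F := fun b hb =>
    hdi b ((show b ⊔ neg b = ⊤ from hb) ▸ hF.1)
  have hsub : genFilter (F ∩ {b : α | Boolean b}) ⊆ F :=
    genFilter_subset hF Set.inter_subset_left
  refine ⟨hbool, ⟨isFilter_genFilter _, ?_, fun h => hF.bot_notMem hproper (hsub h), ?_⟩, hsub⟩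
  · refine Set.Subset.antisymm ?_ (genFilter_subset (isFilter_genFilter _) Set.inter_subset_left)
    exact genFilter_subset (isFilter_genFilter _) fun b hb =>
      subset_genFilter _ ⟨subset_genFilter _ hb, hb.2⟩
  · intro b hb
    exact (hbool b hb).imp (fun h => subset_genFilter _ ⟨h, hb⟩)
      fun h => subset_genFilter _ ⟨h, hb.neg⟩

end BRL
end

section
/- Let A be a bounded residuated lattice and m > 0. Then A satisfies a ∨ ¬(aᵐ) = ⊤ for all a ∈ A if and only if aᵐ is a Boolean element (i.e., aᵐ ∨ ¬(aᵐ) = ⊤) for all a ∈ A. -/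
universe u

namespace BRL

variable {α : Type u} [BRL α]

theorem sup_mul_le {a b c d : α} (hac : mul a c ≤ d) (hbc : mul b c ≤ d) :
    mul (a ⊔ b) c ≤ d :=
  (residuation _ _ _).2 (sup_le ((residuation _ _ _).1 hac) ((residuation _ _ _).1 hbc))

theorem mul_sup_eq_top {a b c : α} (ha : a ⊔ c = ⊤) (hb : b ⊔ c = ⊤) :
    mul a b ⊔ c = ⊤ := by
  have hab : mul (b ⊔ c) a ≤ mul a b ⊔ c :=
    sup_mul_le ((mul_comm b a).le.trans le_sup_left) ((mul_le_left c a).trans le_sup_right)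
  rw [hb, mul_comm, mul_top] at hab
  exact top_le_iff.1 (ha ▸ sup_le hab le_sup_right)

theorem pow_sup_eq_top {a c : α} (h : a ⊔ c = ⊤) (n : ℕ) : pow a n ⊔ c = ⊤ := by
  induction n with
  | zero => exact top_sup_eq c
  | succ n ih => exact mul_sup_eq_top h ih

theorem pow_le_self (a : α) {n : ℕ} (hn : 0 < n) : pow a n ≤ a := by
  cases n with
  | zero => exact absurd hn (lt_irrefl 0)
  | succ n => exact mul_le_left a (pow a n)

theorem semisimple_iff_pow_boolean (m : ℕ) (hm : 0 < m) :
    (∀ a : α, a ⊔ neg (pow a m) = ⊤) ↔ (∀ a : α, Boolean (pow a m)) := by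
  refine ⟨fun h a => pow_sup_eq_top (h a) m, fun h a => top_le_iff.1 ?_⟩
  exact (h a).ge.trans (sup_le_sup_right (pow_le_self a hm) _)

end BRL
end
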